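/- Let h = 2n+1 be an odd integer with n ≥ 1, let 1 ≤ i < n, and let σ be an h-bar-core having at least two addable i-nodes. Then every partition in P_{σ,2} has no removable i-node. -/

import Mathlib

/-- A partition: a weakly decreasing sequence of non-negative integers with
finite sum (finitely many nonzero parts), indexed from 0 (so `parts 0` is λ₁). -/
structure BPartition where
  parts : ℕ →₀ ℕ
  antitone : ∀ r, parts (r + 1) ≤ parts r

namespace BPartition

/-- The multiset of positive parts of a partition. -/
def partsM (lam : BPartition) : Multiset ℕ :=
  lam.parts.support.val.map (fun r => lam.parts r)

/-- The Young diagram: nodes `(r, c)` with rows indexed from 0 and columns from 1. -/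
def diagram (lam : BPartition) : Set (ℕ × ℕ) :=
  {x | 1 ≤ x.2 ∧ x.2 ≤ lam.parts x.1}

/-- A partition is strict if λ_r > λ_{r+1} whenever λ_r > 0. -/
def IsStrict (lam : BPartition) : Prop :=
  ∀ r, 0 < lam.parts r → lam.parts (r + 1) < lam.parts r

/-- A partition is h-strict if each part is either strictly bigger than the next,
or positive and divisible by h, or zero. -/
def IsHStrict (h : ℕ) (lam : BPartition) : Prop :=
  ∀ r, lam.parts (r + 1) < lam.parts r ∨ (0 < lam.parts r ∧ h ∣ lam.parts r) ∨ lam.parts r = 0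

/-- An h-strict partition is restricted if for every r either λ_{r+1} > λ_r − h,
or λ_{r+1} = λ_r − h and h does not divide λ_r. -/
def IsRestricted (h : ℕ) (lam : BPartition) : Prop :=
  ∀ r, lam.parts r < lam.parts (r + 1) + h ∨
    (lam.parts (r + 1) + h = lam.parts r ∧ ¬ h ∣ lam.parts r)

/-- The residue of a node in column c (1-indexed): the smaller of the residues of
c − 1 and of −c modulo h. -/
def colRes (h c : ℕ) : ℕ := min ((c - 1) % h) ((h - c % h) % h)

/-- `x` is an addable i-node of `lam`. -/
def Addable (h i : ℕ) (lam : BPartition) (x : ℕ × ℕ) : Prop :=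
  colRes h x.2 = i ∧ x ∉ diagram lam ∧
  ∃ nu : BPartition, IsHStrict h nu ∧ diagram lam ⊆ diagram nu ∧ x ∈ diagram nu ∧
    ∀ y ∈ diagram nu, y ∉ diagram lam → colRes h y.2 = i

/-- `x` is a removable i-node of `lam`. -/
def Removable (h i : ℕ) (lam : BPartition) (x : ℕ × ℕ) : Prop :=
  x ∈ diagram lam ∧
  ∃ mu : BPartition, IsHStrict h mu ∧ diagram mu ⊆ diagram lam ∧ x ∉ diagram mu ∧
    ∀ y ∈ diagram lam, y ∉ diagram mu → colRes h y.2 = i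

/-- Removal of a single h-bar from `lam` giving `mu`, recording the value `v`:
either a part `v ≥ h` is replaced by `v − h` (deleted if `v = h`), or two parts
summing to `h` are deleted, in which case `v` is the larger of the two. -/
def barStepRec (h : ℕ) (lam mu : BPartition) (v : ℕ) : Prop :=
  IsHStrict h mu ∧
  ((v = h ∧ v ∈ partsM lam ∧ partsM mu = (partsM lam).erase v) ∨
   (h < v ∧ v ∈ partsM lam ∧ partsM mu = (v - h) ::ₘ (partsM lam).erase v) ∨
   (∃ a b : ℕ, a + b = h ∧ a ∈ partsM lam ∧ b ∈ (partsM lam).erase a ∧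
      v = max a b ∧ partsM mu = ((partsM lam).erase a).erase b))

/-- Removal of a single h-bar. -/
def barStep (h : ℕ) (lam mu : BPartition) : Prop :=
  ∃ v, barStepRec h lam mu v

/-- An h-bar-core: an h-strict partition from which no h-bar can be removed. -/
def IsBarCore (h : ℕ) (lam : BPartition) : Prop :=
  IsHStrict h lam ∧ ∀ mu, ¬ barStep h lam mu

/-- A chain of `w` h-bar removals from `lam` down to `mu`. -/
def barChain (h : ℕ) : ℕ → BPartition → BPartition → Prop
  | 0, lam, mu => lam = mu
  | w + 1, lam, mu => ∃ nu, barStep h lam nu ∧ barChain h w nu mu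

/-- `lam ∈ P_{τ,w}`: `lam` is h-strict with h-bar-core `tau` and h-bar-weight `w`. -/
def InBlock (h : ℕ) (tau : BPartition) (w : ℕ) (lam : BPartition) : Prop :=
  IsHStrict h lam ∧ IsBarCore h tau ∧ barChain h w lam tau

/-- The left-to-right order on node positions along the edge of a Young diagram:
smaller column first; within a column, larger row first. -/
def posLE (x y : ℕ × ℕ) : Prop := x.2 < y.2 ∨ (x.2 = y.2 ∧ y.1 ≤ x.1)

/-- `x` is a normal i-node: a removable i-node surviving (as a − sign) in the
reduced i-signature; equivalently, every window of the i-signature ending at `x`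
contains strictly more removable than addable i-nodes. -/
def Normal (h i : ℕ) (lam : BPartition) (x : ℕ × ℕ) : Prop :=
  Removable h i lam x ∧ ∀ z : ℕ × ℕ, posLE z x →
    Set.ncard {y | Addable h i lam y ∧ posLE z y ∧ posLE y x} <
      Set.ncard {y | Removable h i lam y ∧ posLE z y ∧ posLE y x}

/-- `x` is a conormal i-node: an addable i-node surviving (as a + sign) in the
reduced i-signature. -/
def Conormal (h i : ℕ) (lam : BPartition) (x : ℕ × ℕ) : Prop :=
  Addable h i lam x ∧ ∀ z : ℕ × ℕ, posLE x z →
    Set.ncard {y | Removable h i lam y ∧ posLE x y ∧ posLE y z} <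
      Set.ncard {y | Addable h i lam y ∧ posLE x y ∧ posLE y z}

/-- The node set of ψ_i(λ): add the leftmost s − r conormal i-nodes if s ≥ r,
remove the rightmost r − s normal i-nodes if r > s, where r = #normal and
s = #conormal i-nodes. -/
noncomputable def psiSet (h i : ℕ) (lam : BPartition) : Set (ℕ × ℕ) :=
  if Set.ncard {x | Normal h i lam x} ≤ Set.ncard {x | Conormal h i lam x} then
    diagram lam ∪ {x | Conormal h i lam x ∧
      Set.ncard {y | Conormal h i lam y ∧ posLE y x} ≤
        Set.ncard {x | Conormal h i lam x} - Set.ncard {x | Normal h i lam x}}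
  else
    diagram lam \ {x | Normal h i lam x ∧
      Set.ncard {y | Normal h i lam y ∧ posLE x y} ≤
        Set.ncard {x | Normal h i lam x} - Set.ncard {x | Conormal h i lam x}}

open Classical in
/-- The involution ψ_i. -/
noncomputable def psi (h i : ℕ) (lam : BPartition) : BPartition :=
  if hex : ∃ mu : BPartition, diagram mu = psiSet h i lam then hex.choose else lam

/-- The set of occupied positions of the abacus display of a strict partition. -/
def abacus (lam : BPartition) : Set ℤ :=
  {a | a = 0 ∨ (0 < a ∧ a.toNat ∈ partsM lam) ∨ (a < 0 ∧ (-a).toNat ∉ partsM lam)}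

/-- The dominance order: λ ⊴ μ. -/
def domLE (lam mu : BPartition) : Prop :=
  ∀ r, ∑ s ∈ Finset.range r, lam.parts s ≤ ∑ s ∈ Finset.range r, mu.parts s

/-- Strict dominance: λ ◁ μ. -/
def domLT (lam mu : BPartition) : Prop := domLE lam mu ∧ lam ≠ mu

/-- Lexicographic order: λ <lex μ. -/
def lexLT (lam mu : BPartition) : Prop :=
  ∃ r, lam.parts r < mu.parts r ∧ ∀ s < r, lam.parts s = mu.parts s

/-- Colexicographic order: λ <colex μ. -/
def colexLT (lam mu : BPartition) : Prop :=
  ∃ r, mu.parts r < lam.parts r ∧ ∀ s, r < s → lam.parts s = mu.parts s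

/-- λ ↔ᵢ μ: every node of the symmetric difference of the diagrams has residue i. -/
def Link (h i : ℕ) (lam mu : BPartition) : Prop :=
  ∀ x : ℕ × ℕ, x ∈ (diagram lam \ diagram mu) ∪ (diagram mu \ diagram lam) →
    colRes h x.2 = i

/-- `a ≤ b` are the bar positions of `lam ∈ P_{τ,2}`: the values recorded by
some two-step removal of h-bars from `lam` down to `tau`. -/
def BarPositions (h : ℕ) (tau lam : BPartition) (a b : ℕ) : Prop :=
  a ≤ b ∧ ∃ (nu : BPartition) (v₁ v₂ : ℕ), barStepRec h lam nu v₁ ∧ barStepRec h nu tau v₂ ∧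
    ({a, b} : Multiset ℕ) = {v₁, v₂}

/-- The leg length of the bar of `lam ∈ P_{τ,2}` at bar position `c`. -/
noncomputable def legLen (h : ℕ) (tau lam : BPartition) (c : ℕ) : ℕ :=
  if h ≤ c then Set.ncard {x : ℕ | c - h < x ∧ x < c ∧ x ∈ partsM lam ∧ x ∈ partsM tau}
  else (h - c) + Set.ncard {x : ℕ | h - c < x ∧ x < c ∧ x ∈ partsM lam ∧ x ∈ partsM tau}

/-- ∂λ: the absolute difference of the two leg lengths of `lam`, whose bar
positions are `a ≤ b`. -/
noncomputable def ddd (h : ℕ) (tau lam : BPartition) (a b : ℕ) : ℕ :=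
  max (legLen h tau lam a) (legLen h tau lam b) - min (legLen h tau lam a) (legLen h tau lam b)

inductive Colour | black | white | grey
deriving DecidableEq

/-- β(τ): the number of parts of τ less than h. -/
def betaCount (h : ℕ) (tau : BPartition) : ℕ :=
  Multiset.card ((partsM tau).filter (fun x => x < h))

/-- The leg length of a 2h-bar of `lam` with larger bar position `b`. -/
noncomputable def legLen2 (h : ℕ) (tau lam : BPartition) (b : ℕ) : ℕ :=
  if 2 * h ≤ b then Set.ncard {x : ℕ | b - 2 * h < x ∧ x < b ∧ x ∈ partsM lam ∧ x ∈ partsM tau}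
  else (2 * h - b) + Set.ncard {x : ℕ | 2 * h - b < x ∧ x < b ∧ x ∈ partsM lam ∧ x ∈ partsM tau}

/-- The colour of `lam ∈ P_{τ,2}` with bar positions `a ≤ b`. -/
noncomputable def colour (h : ℕ) (tau lam : BPartition) (a b : ℕ) : Colour :=
  if 2 ≤ ddd h tau lam a b then Colour.grey
  else if ddd h tau lam a b = 1 then
    if h < b then Colour.grey
    else if (min (legLen h tau lam a) (legLen h tau lam b) + betaCount h tau) % 2 = 1 then
      Colour.black else Colour.white
  else
    if b = a + h ∨ a + b = 2 * h then
      if (legLen2 h tau lam b + 2 * betaCount h tau) % 4 = 0 ∨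
         (legLen2 h tau lam b + 2 * betaCount h tau) % 4 = 3 then Colour.black
      else Colour.white
    else
      if (legLen h tau lam a + betaCount h tau) % 2 = 1 then Colour.black else Colour.white

end BPartition

namespace BPartition

theorem anti (lam : BPartition) {r s : ℕ} (hrs : r ≤ s) : lam.parts s ≤ lam.parts r :=
  antitone_nat_of_succ_le (f := fun r => lam.parts r) lam.antitone hrs

theorem mem_partsM (lam : BPartition) (v : ℕ) :
    v ∈ partsM lam ↔ 0 < v ∧ ∃ r, lam.parts r = v := by
  unfold partsM
  simp only [Multiset.mem_map, Finset.mem_val, Finsupp.mem_support_iff]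
  constructor
  · rintro ⟨r, h1, h2⟩
    exact ⟨by omega, r, h2⟩
  · rintro ⟨h1, r, h2⟩
    exact ⟨r, by omega, h2⟩

theorem eq_row {h : ℕ} {lam : BPartition} (hl : IsHStrict h lam) {r s : ℕ}
    (hd : ¬ h ∣ lam.parts r) (he : lam.parts r = lam.parts s) : r = s := by
  by_contra hne
  have h0 : lam.parts r ≠ 0 := by
    intro h0
    rw [h0] at hd
    exact hd (dvd_zero h)
  rcases lt_or_gt_of_ne hne with hlt | hlt
  · have h1 := lam.anti (show r + 1 ≤ s from hlt)
    rcases hl r with h2 | h2 | h2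
    · omega
    · exact hd h2.2
    · omega
  · have h1 := lam.anti (show s + 1 ≤ r from hlt)
    rcases hl s with h2 | h2 | h2
    · omega
    · rw [he] at hd
      exact hd h2.2
    · omega

theorem count_le {h : ℕ} {lam : BPartition} (hl : IsHStrict h lam) {v : ℕ}
    (hd : ¬ h ∣ v) : (partsM lam).count v ≤ 1 := by
  unfold partsM
  rw [Multiset.count_map]
  change (Finset.filter (fun r => v = lam.parts r) lam.parts.support).card ≤ 1
  rw [Finset.card_le_one]
  intro a ha b hb
  rw [Finset.mem_filter] at ha hb
  apply eq_row hl
  · rw [← ha.2]; exact hd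
  · rw [← ha.2, ← hb.2]

theorem exists_of_multiset (h : ℕ) (M : Multiset ℕ) (h0 : 0 ∉ M)
    (hM : ∀ v, ¬ h ∣ v → M.count v ≤ 1) :
    ∃ mu : BPartition, IsHStrict h mu ∧ partsM mu = M := by
  obtain ⟨l, hl, hs⟩ : ∃ l : List ℕ, (l : Multiset ℕ) = M ∧ l.Pairwise (· ≥ ·) :=
    ⟨M.sort (· ≥ ·), by simp, by simp⟩
  subst hl
  have hpos : ∀ r (hr : r < l.length), 0 < l[r] := by
    intro r hr
    rcases Nat.eq_zero_or_pos l[r] with h1 | h1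
    · exact absurd (by rw [← h1]; exact Multiset.mem_coe.2 (List.getElem_mem hr)) h0
    · exact h1
  have hle : ∀ r (hr : r + 1 < l.length), l[r+1] ≤ l[r] := by
    intro r hr
    exact List.pairwise_iff_getElem.1 hs r (r+1) (by omega) hr (by omega)
  have hin : ∀ r (hr : r < l.length), l.getD r 0 = l[r] := by
    intro r hr
    simp [hr]
  have hout : ∀ r, l.length ≤ r → l.getD r 0 = 0 := by
    intro r hr
    simp [hr]
  let f : ℕ →₀ ℕ := Finsupp.onFinset (Finset.range l.length) (fun r => l.getD r 0) (by
    intro r hr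
    rw [Finset.mem_range]
    by_contra hc
    exact hr (hout r (by omega)))
  have hf : ∀ r, f r = l.getD r 0 := fun r => rfl
  have hsup : f.support = Finset.range l.length := by
    ext r
    rw [Finsupp.mem_support_iff, Finset.mem_range, hf]
    constructor
    · intro hr
      by_contra hc
      exact hr (hout r (by omega))
    · intro hr
      rw [hin r hr]
      have := hpos r hr
      omega
  refine ⟨⟨f, ?_⟩, ?_, ?_⟩
  · intro r
    rw [hf, hf]
    by_cases hr : r + 1 < l.length
    · rw [hin _ hr, hin r (by omega)]
      exact hle r hr
    · rw [hout (r+1) (by omega)]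
      omega
  · intro r
    change f (r+1) < f r ∨ (0 < f r ∧ h ∣ f r) ∨ f r = 0
    rw [hf, hf]
    by_cases hr : r + 1 < l.length
    · rw [hin _ hr, hin r (by omega)]
      by_cases hlt : l[r+1] < l[r]
      · exact Or.inl hlt
      · right; left
        refine ⟨hpos r (by omega), ?_⟩
        by_contra hd
        have h1 := hM _ hd
        have h2 : List.Duplicate l[r] l := by
          rw [List.duplicate_iff_exists_distinct_get]
          refine ⟨⟨r, by omega⟩, ⟨r+1, hr⟩, ?_, ?_, ?_⟩
          · simp
          · simp
          · have := hle r hr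
            simp
            omega
        rw [List.duplicate_iff_two_le_count] at h2
        rw [Multiset.coe_count] at h1
        omega
    · rw [hout (r+1) (by omega)]
      omega
  · change Multiset.map (fun r => f r) f.support.val = _
    rw [hsup]
    simp only [hf, Finset.range_val, Multiset.range, Multiset.map_coe]
    congr 1
    apply List.ext_getElem
    · simp
    · intro k h1 h2
      simp [h2]

theorem ab_pos (lam : BPartition) {v : ℕ} (hv : 0 < v) :
    ((v : ℤ) ∈ abacus lam) ↔ v ∈ partsM lam := by
  unfold abacus
  simp only [Set.mem_setOf_eq, Int.toNat_natCast]
  constructor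
  · rintro (h | h | h)
    · omega
    · exact h.2
    · omega
  · intro h
    exact Or.inr (Or.inl ⟨by omega, h⟩)

theorem ab_neg (lam : BPartition) {v : ℕ} (hv : 0 < v) :
    (-(v : ℤ) ∈ abacus lam) ↔ v ∉ partsM lam := by
  unfold abacus
  simp only [Set.mem_setOf_eq, neg_neg, Int.toNat_natCast]
  constructor
  · rintro (h | h | h)
    · omega
    · omega
    · exact h.2
  · intro h
    exact Or.inr (Or.inr ⟨by omega, h⟩)

theorem ab_symm (lam : BPartition) {x : ℤ} (hx : x ≠ 0) :
    (-x ∈ abacus lam) ↔ x ∉ abacus lam := by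
  rcases lt_or_gt_of_ne hx with h | h
  · obtain ⟨v, rfl⟩ : ∃ v : ℕ, x = -(v:ℤ) := ⟨x.natAbs, by omega⟩
    rw [neg_neg, ab_pos lam (by omega), ab_neg lam (by omega), not_not]
  · obtain ⟨v, rfl⟩ : ∃ v : ℕ, x = (v:ℤ) := ⟨x.natAbs, by omega⟩
    rw [ab_pos lam (by omega), ab_neg lam (by omega)]

/-- parts-level description of a step -/
theorem step_parts {h : ℕ} (hh : 0 < h) {lam mu : BPartition} (hl : IsHStrict h lam)
    (hs : barStep h lam mu) :
    (∀ v, ¬ h ∣ v → (v ∈ partsM lam ↔ v ∈ partsM mu)) ∨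
    ∃ y : ℤ, ¬ (h:ℤ) ∣ y ∧ y ∈ abacus mu ∧ y + h ∉ abacus mu ∧
      ∀ v : ℕ, ¬ h ∣ v → ((v:ℤ) = y ∨ (v:ℤ) = y + h ∨ (v:ℤ) = -y ∨ (v:ℤ) = -y-h) ∨
        (v ∈ partsM lam ↔ v ∈ partsM mu) := by
  obtain ⟨v, hmu, h1 | h1 | ⟨a, b, hab, ha, hb, -, he⟩⟩ := hs
  · left
    intro w hw
    rw [h1.2.2, Multiset.mem_erase_of_ne]
    rintro rfl
    exact hw (by rw [h1.1])
  · obtain ⟨h1, h2, h3⟩ := h1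
    by_cases hd : h ∣ v
    · left
      intro w hw
      rw [h3, Multiset.mem_cons, Multiset.mem_erase_of_ne]
      · constructor
        · exact Or.inr
        · rintro (h4 | h4)
          · rw [h4] at hw
            exact absurd (Nat.dvd_sub hd dvd_rfl) hw
          · exact h4
      · rintro rfl
        exact hw hd
    · right
      refine ⟨((v - h : ℕ) : ℤ), ?_, ?_, ?_, ?_⟩
      · rw [Int.natCast_dvd_natCast]
        intro h4
        exact hd (by have := Nat.dvd_add h4 (dvd_refl h); rwa [Nat.sub_add_cancel h1.le] at this)
      · rw [ab_pos mu (by omega), h3]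
        exact Multiset.mem_cons_self _ _
      · rw [show ((v - h : ℕ) : ℤ) + h = (v : ℕ) by omega, ab_pos mu (by omega), h3,
          Multiset.mem_cons]
        rintro (h4 | h4)
        · omega
        · have := count_le hl hd
          have h5 := Multiset.one_le_count_iff_mem.2 h4
          rw [Multiset.count_erase_self] at h5
          omega
      · intro w hw
        by_cases h4 : w = v
        · left; right; left; omega
        by_cases h5 : w = v - h
        · left; left; omega
        right
        rw [h3, Multiset.mem_cons, Multiset.mem_erase_of_ne h4]
        tauto
  · right
    have ha0 := ((mem_partsM _ _).1 ha).1
    have hb0 := ((mem_partsM _ _).1 (Multiset.mem_of_mem_erase hb)).1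
    have hda : ¬ h ∣ a := fun hc => by have := Nat.le_of_dvd ha0 hc; omega
    have hdb : ¬ h ∣ b := fun hc => by have := Nat.le_of_dvd hb0 hc; omega
    have hca := count_le hl hda
    have hcb := count_le hl hdb
    refine ⟨-(a:ℤ), ?_, ?_, ?_, ?_⟩
    · rw [dvd_neg, Int.natCast_dvd_natCast]
      exact hda
    · rw [ab_neg mu ha0, he]
      intro h4
      have h5 := Multiset.one_le_count_iff_mem.2 (Multiset.mem_of_mem_erase h4)
      rw [Multiset.count_erase_self] at h5
      omega
    · rw [show -(a:ℤ) + h = (b:ℕ) by omega, ab_pos mu hb0, he]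
      intro h4
      have h5 := Multiset.one_le_count_iff_mem.2 h4
      have h6 := Multiset.count_le_of_le b (Multiset.erase_le a (partsM lam))
      rw [Multiset.count_erase_self] at h5
      omega
    · intro w hw
      by_cases h4 : w = a
      · left; omega
      by_cases h5 : w = b
      · left; omega
      right
      rw [he, Multiset.mem_erase_of_ne h5, Multiset.mem_erase_of_ne h4]

theorem step_ab {h : ℕ} (hh : 0 < h) {lam mu : BPartition} (hl : IsHStrict h lam)
    (hs : barStep h lam mu) :
    (∀ x : ℤ, ¬ (h:ℤ) ∣ x → (x ∈ abacus lam ↔ x ∈ abacus mu)) ∨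
    ∃ y : ℤ, y ∈ abacus mu ∧ y + h ∉ abacus mu ∧ -y ∉ abacus mu ∧ -y-h ∈ abacus mu ∧
      ∀ x : ℤ, ¬ (h:ℤ) ∣ x → (x = y ∨ x = y + h ∨ x = -y ∨ x = -y-h) ∨
        (x ∈ abacus lam ↔ x ∈ abacus mu) := by
  have key : ∀ x : ℤ, ¬ (h:ℤ) ∣ x → ∃ v : ℕ, ¬ h ∣ v ∧ 0 < v ∧ (x = v ∨ x = -v) := by
    intro x hx
    refine ⟨x.natAbs, ?_, ?_, by omega⟩
    · rwa [← Int.natCast_dvd]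
    · rcases Nat.eq_zero_or_pos x.natAbs with h1 | h1
      · rw [Int.natAbs_eq_zero] at h1
        subst h1
        exact absurd (dvd_zero _) hx
      · exact h1
  rcases step_parts hh hl hs with h1 | ⟨y, hy, h1, h2, h3⟩
  · left
    intro x hx
    obtain ⟨v, hv, hv0, rfl | rfl⟩ := key x hx
    · rw [ab_pos _ hv0, ab_pos _ hv0, h1 v hv]
    · rw [ab_neg _ hv0, ab_neg _ hv0, h1 v hv]
  · right
    have hy0 : y ≠ 0 := by rintro rfl; exact hy (dvd_zero _)
    have hy1 : y + h ≠ 0 := by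
      intro h4
      apply hy
      rw [show y = -(h:ℤ) by omega]
      simp
    refine ⟨y, h1, h2, ?_, ?_, ?_⟩
    · rw [ab_symm _ hy0]; simpa using h1
    · rw [show -y - (h:ℤ) = -(y+h) by ring, ab_symm _ hy1]; exact h2
    · intro x hx
      obtain ⟨v, hv, hv0, rfl | rfl⟩ := key x hx
      · rw [ab_pos _ hv0, ab_pos _ hv0]
        exact h3 v hv
      · rw [ab_neg _ hv0, ab_neg _ hv0, not_iff_not]
        rcases h3 v hv with h4 | h4
        · left; omega
        · exact Or.inr h4

theorem core_down {h : ℕ} (hh : 0 < h) (hodd : h % 2 = 1) {sg : BPartition} (hs : IsBarCore h sg) {x : ℤ}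
    (hx : ¬ (h:ℤ) ∣ x) (hm : x ∈ abacus sg) : x - h ∈ abacus sg := by
  have hsub : ∀ M : Multiset ℕ, M ≤ partsM sg → 0 ∉ M ∧ ∀ v, ¬ h ∣ v → M.count v ≤ 1 := by
    intro M hM
    constructor
    · intro h0
      have := ((mem_partsM _ _).1 (Multiset.mem_of_le hM h0)).1
      omega
    · intro v hv
      exact (Multiset.count_le_of_le v hM).trans (count_le hs.1 hv)
  have big : ∀ v : ℕ, h < v → v ∈ partsM sg → v - h ∈ partsM sg := by
    intro v hv hvm
    by_contra hc
    obtain ⟨h1, h2⟩ := hsub _ (Multiset.erase_le v (partsM sg))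
    obtain ⟨mu, hmu, he⟩ := exists_of_multiset h ((v - h) ::ₘ (partsM sg).erase v)
      (by
        rw [Multiset.mem_cons]
        rintro (h3 | h3)
        · omega
        · exact h1 h3)
      (by
        intro w hw
        by_cases hwv : w = v - h
        · rw [hwv, Multiset.count_cons_self, Multiset.count_eq_zero_of_notMem]
          intro h4
          exact hc (Multiset.mem_of_mem_erase h4)
        · rw [Multiset.count_cons_of_ne hwv]
          exact h2 w hw)
    exact hs.2 mu ⟨v, hmu, Or.inr (Or.inl ⟨hv, hvm, he⟩)⟩
  rcases lt_trichotomy x 0 with h1 | h1 | h1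
  · obtain ⟨v, rfl⟩ : ∃ v : ℕ, x = -(v:ℤ) := ⟨x.natAbs, by omega⟩
    rw [ab_neg _ (by omega)] at hm
    rw [show -(v:ℤ) - h = -((v + h : ℕ):ℤ) by push_cast; ring, ab_neg _ (by omega)]
    intro h2
    have := big _ (by omega) h2
    rw [Nat.add_sub_cancel] at this
    exact hm this
  · subst h1
    exact absurd (dvd_zero _) hx
  · obtain ⟨v, rfl⟩ : ∃ v : ℕ, x = (v:ℤ) := ⟨x.natAbs, by omega⟩
    rw [ab_pos _ (by omega)] at hm
    rcases lt_trichotomy v h with h2 | h2 | h2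
    · obtain ⟨w, hw⟩ : ∃ w : ℕ, v + w = h := ⟨h - v, by omega⟩
      rw [show (v:ℤ) - h = -((w : ℕ):ℤ) by omega, ab_neg _ (by omega)]
      intro h3
      by_cases hvw : w = v
      · omega
      · obtain ⟨h4, h5⟩ := hsub (((partsM sg).erase v).erase w)
          ((Multiset.erase_le _ _).trans (Multiset.erase_le _ _))
        obtain ⟨mu, hmu, he⟩ := exists_of_multiset h _ h4 h5
        exact hs.2 mu ⟨max v w, hmu, Or.inr (Or.inr ⟨v, w, hw, hm,
          (Multiset.mem_erase_of_ne hvw).2 h3, rfl, he⟩)⟩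
    · subst h2
      exact absurd dvd_rfl hx
    · rw [show (v:ℤ) - h = ((v - h : ℕ):ℤ) by omega, ab_pos _ (by omega)]
      exact big v h2 hm

/-- The invariant. -/
def Inv (h i : ℕ) (m : ℤ) (lam : BPartition) : Prop :=
  ∃ s t : ℤ, t ≤ s + m - 1 ∧ (∀ k ≤ s, (i:ℤ) + k * h ∈ abacus lam) ∧
    ∀ k ≥ t, (i:ℤ) + 1 + k * h ∉ abacus lam

theorem ndvd {h i : ℕ} (h1 : 1 ≤ i) (h2 : 2 * i + 2 < h) (a k : ℤ) (ha : 0 < a) (ha2 : a < h) :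
    ¬ (h:ℤ) ∣ a + k * h := by
  intro hc
  rw [Int.dvd_add_left (Dvd.intro_left k rfl)] at hc
  have := Int.le_of_dvd ha hc
  omega

theorem inv_step {h i : ℕ} (h1 : 1 ≤ i) (h2 : 2 * i + 2 < h) {m : ℤ} {lam mu : BPartition}
    (hl : IsHStrict h lam) (hs : barStep h lam mu) (hI : Inv h i m mu) :
    Inv h i (m + 1) lam := by
  obtain ⟨s, t, hst, hB, hC⟩ := hI
  have nB : ∀ k : ℤ, ¬ (h:ℤ) ∣ (i:ℤ) + k * h := fun k => ndvd h1 h2 _ k (by omega) (by omega)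
  have nC : ∀ k : ℤ, ¬ (h:ℤ) ∣ (i:ℤ) + 1 + k * h := fun k => ndvd h1 h2 _ k (by omega) (by omega)
  rcases step_ab (by omega) hl hs with hu | ⟨y, y1, y2, y3, y4, hu⟩
  · refine ⟨s, t, by omega, ?_, ?_⟩
    · intro k hk
      rw [hu _ (nB k)]; exact hB k hk
    · intro k hk
      rw [hu _ (nC k)]; exact hC k hk
  by_cases hB' : ∀ k ≤ s, (i:ℤ) + k * h ∈ abacus lam
  · refine ⟨s, t + 1, by omega, hB', ?_⟩
    intro k hk hm
    have hk1 := hC k (by omega)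
    have hk2 := hC (k-1) (by omega)
    rw [show (i:ℤ) + 1 + (k-1)*h = (i:ℤ) + 1 + k * h - h by ring] at hk2
    rcases hu _ (nC k) with (e | e | e | e) | e
    · rw [e] at hk1; exact hk1 y1
    · rw [e, add_sub_cancel_right] at hk2; exact hk2 y1
    · rw [e] at hk2; exact hk2 y4
    · rw [e] at hk1; exact hk1 y4
    · exact hk1 (e.1 hm)
  · push Not at hB'
    obtain ⟨k0, hk0, hn⟩ := hB'
    have hm0 := hB k0 hk0
    have hy : y = (i:ℤ) + k0 * h ∨ y = -((i:ℤ) + k0 * h) - h := by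
      rcases hu _ (nB k0) with (e | e | e | e) | e
      · left; omega
      · rw [e] at hm0; exact absurd hm0 y2
      · rw [e] at hm0; exact absurd hm0 y3
      · right; omega
      · exact absurd (e.2 hm0) hn
    refine ⟨s - 1, t, by omega, ?_, ?_⟩
    · intro k hk
      have hk1 := hB k (by omega)
      have hk2 := hB (k+1) (by omega)
      rw [show (i:ℤ) + (k+1)*h = (i:ℤ) + k * h + h by ring] at hk2
      rcases hu _ (nB k) with (e | e | e | e) | e
      · rw [e] at hk2; exact absurd hk2 y2
      · rw [e] at hk1; exact absurd hk1 y2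
      · rw [e] at hk1; exact absurd hk1 y3
      · rw [e, sub_add_cancel] at hk2; exact absurd hk2 y3
      · exact e.2 hk1
    · intro k hk hm
      have hk1 := hC k hk
      have d1 : ∀ q : ℤ, (i:ℤ) + 1 + k * h ≠ i + q * h := by
        intro q hq
        apply ndvd h1 h2 1 (k - q) (by omega) (by omega)
        rw [show 1 + (k-q) * h = 0 by linear_combination hq]
        exact dvd_zero _
      have d2 : ∀ q : ℤ, (i:ℤ) + 1 + k * h ≠ -i + q * h := by
        intro q hq
        apply ndvd h1 h2 (2 * i + 1) (k - q) (by omega) (by omega)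
        rw [show 2 * (i:ℤ) + 1 + (k-q) * h = 0 by linear_combination hq]
        exact dvd_zero _
      rcases hu _ (nC k) with e | e
      · rcases hy with rfl | rfl
        · rcases e with e | e | e | e
          · exact d1 _ e
          · exact d1 (k0+1) (by linear_combination e)
          · exact d2 (-k0) (by linear_combination e)
          · exact d2 (-k0-1) (by linear_combination e)
        · rcases e with e | e | e | e
          · exact d2 (-k0-1) (by linear_combination e)
          · exact d2 (-k0) (by linear_combination e)
          · exact d1 (k0+1) (by linear_combination e)
          · exact d1 k0 (by linear_combination e)
      · exact hk1 (e.1 hm)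

theorem colRes_eq {h i c : ℕ} (h1 : 1 ≤ i) (h2 : 2 * i + 2 < h) (hc : 1 ≤ c)
    (he : colRes h c = i) : ∃ q : ℕ, c = i + 1 + q * h ∨ c = h - i + q * h := by
  unfold colRes at he
  have hm := Nat.mod_add_div c h
  have hlt := Nat.mod_lt c (show 0 < h by omega)
  rw [mul_comm] at hm
  refine ⟨c / h, ?_⟩
  by_cases h0 : c % h = 0
  · rw [h0] at he
    simp at he
    omega
  have e2 : (c - 1) % h = c % h - 1 := by
    have : c - 1 = (c % h - 1) + (c / h) * h := by omega
    rw [this, Nat.add_mul_mod_self_right, Nat.mod_eq_of_lt (by omega)]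
  rw [e2, Nat.mod_eq_of_lt (show h - c % h < h by omega)] at he
  omega

/-- a column of residue i: relevant facts -/
theorem col_facts {h i c : ℕ} (h1 : 1 ≤ i) (h2 : 2 * i + 2 < h) (hc : 1 ≤ c)
    (he : colRes h c = i) : 2 ≤ c ∧ ¬ h ∣ c ∧ ¬ h ∣ (c - 1) ∧ colRes h (c+1) ≠ i ∧
      colRes h (c-1) ≠ i := by
  have mm : ∀ a q : ℕ, a < h → (a + q * h) % h = a := by
    intro a q ha
    rw [Nat.add_mul_mod_self_right, Nat.mod_eq_of_lt ha]
  obtain ⟨q, hq⟩ := colRes_eq h1 h2 hc he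
  obtain ⟨a, ha, hac, e⟩ : ∃ a, (a = i + 1 ∨ a = h - i) ∧ a < h ∧ c = a + q * h := by
    rcases hq with e | e
    · exact ⟨i + 1, Or.inl rfl, by omega, e⟩
    · exact ⟨h - i, Or.inr rfl, by omega, e⟩
  have e0 : c % h = a := by rw [e, mm _ _ hac]
  have e1 : (c - 1) % h = a - 1 := by
    rw [show c - 1 = (a - 1) + q * h by omega, mm _ _ (by omega)]
  refine ⟨by omega, ?_, ?_, ?_, ?_⟩
  · rw [Nat.dvd_iff_mod_eq_zero]; omega
  · rw [Nat.dvd_iff_mod_eq_zero]; omega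
  · intro hr
    obtain ⟨q', hq'⟩ := colRes_eq h1 h2 (by omega) hr
    have e3 : (c + 1) % h = if a + 1 = h then 0 else a + 1 := by
      rw [e, show a + q * h + 1 = a + 1 + q * h by ring, Nat.add_mul_mod_self_right]
      split_ifs with h5
      · rw [h5, Nat.mod_self]
      · exact Nat.mod_eq_of_lt (by omega)
    rcases hq' with e' | e'
    · rw [e', mm _ _ (by omega)] at e3
      split_ifs at e3 <;> omega
    · rw [e', mm _ _ (by omega)] at e3
      split_ifs at e3 <;> omega
  · intro hr
    obtain ⟨q', hq'⟩ := colRes_eq h1 h2 (by omega) hr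
    rcases hq' with e' | e'
    · rw [e', mm _ _ (by omega)] at e1
      omega
    · rw [e', mm _ _ (by omega)] at e1
      omega

theorem col_mul {h i c : ℕ} (h1 : 1 ≤ i) (h2 : 2 * i + 2 < h) (hc : 1 ≤ c)
    (he : colRes h c = i) (lam : BPartition) :
    ∃ k : ℤ, ((i:ℤ) + k * h = c - 1 ∨ (i:ℤ) + k * h = -c) ∧
      (c - 1 ∈ partsM lam → c ∉ partsM lam →
        (i:ℤ) + k * h ∈ abacus lam ∧ (i:ℤ) + 1 + k * h ∉ abacus lam) ∧
      (c ∈ partsM lam → c - 1 ∉ partsM lam →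
        (i:ℤ) + k * h ∉ abacus lam ∧ (i:ℤ) + 1 + k * h ∈ abacus lam) := by
  obtain ⟨q, hq⟩ := colRes_eq h1 h2 hc he
  have h3 := (col_facts h1 h2 hc he).1
  rcases hq with e | e
  · have e1 : (i:ℤ) + q * h = ((c - 1 : ℕ) : ℤ) := by
      have : ((c:ℕ):ℤ) = i + 1 + q * h := by exact_mod_cast e
      omega
    have e2 : (i:ℤ) + 1 + q * h = (c : ℤ) := by omega
    refine ⟨q, by omega, ?_, ?_⟩
    all_goals
      rw [e1, e2, ab_pos _ (by omega), ab_pos _ (by omega)]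
      tauto
  · have e0 : ((c:ℕ):ℤ) = h - i + q * h := by
      have : ((c + i : ℕ):ℤ) = ((h + q * h : ℕ) : ℤ) := by
        congr 1
        omega
      push_cast at this
      linarith
    have e1 : (i:ℤ) + (-q-1) * h = -(c : ℤ) := by linear_combination e0
    have e2 : (i:ℤ) + 1 + (-q-1) * h = -((c - 1 : ℕ) : ℤ) := by
      rw [show (i:ℤ) + 1 + (-q-1) * h = (i:ℤ) + (-q-1) * h + 1 by ring, e1]
      omega
    refine ⟨-q-1, by omega, ?_, ?_⟩
    all_goals
      rw [e1, e2, ab_neg _ (by omega), ab_neg _ (by omega)]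
      tauto

theorem diag_le {a b : BPartition} (hab : diagram a ⊆ diagram b) (r : ℕ) :
    a.parts r ≤ b.parts r := by
  by_contra hc
  have := hab (show (r, a.parts r) ∈ diagram a from ⟨by simp; omega, le_rfl⟩)
  have := this.2
  simp at this
  omega

/-- If all nodes of nu∖lam have residue i, rows differ by at most one. -/
theorem row_diff {h i : ℕ} (h1 : 1 ≤ i) (h2 : 2 * i + 2 < h) {lam nu : BPartition}
    (hr : ∀ y ∈ diagram nu, y ∉ diagram lam → colRes h y.2 = i) (r : ℕ) :
    nu.parts r ≤ lam.parts r + 1 := by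
  by_contra hc
  have a1 := hr (r, lam.parts r + 1) ⟨by simp, by simp; omega⟩ (fun hx => by have := hx.2; simp at this)
  have a2 := hr (r, lam.parts r + 2) ⟨by simp, by simp; omega⟩ (fun hx => by have := hx.2; simp at this)
  exact (col_facts h1 h2 (by simp) a1).2.2.2.1 a2

theorem addable_facts {h i : ℕ} (h1 : 1 ≤ i) (h2 : 2 * i + 2 < h) {lam : BPartition}
    {x : ℕ × ℕ} (ha : Addable h i lam x) :
    1 ≤ x.2 ∧ lam.parts x.1 = x.2 - 1 ∧ x.2 - 1 ∈ partsM lam ∧ x.2 ∉ partsM lam := by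
  obtain ⟨hres, hx, nu, hnu, hsub, hxn, hr⟩ := ha
  obtain ⟨r, c⟩ := x
  obtain ⟨hc, hcn⟩ := hxn
  simp only at *
  have hlt : lam.parts r < c := by
    by_contra hcon
    exact hx ⟨hc, by simp; omega⟩
  have hd := row_diff h1 h2 hr r
  obtain ⟨f1, f2, f3, f4, f5⟩ := col_facts h1 h2 hc hres
  have hp : lam.parts r = c - 1 := by omega
  refine ⟨hc, hp, (mem_partsM _ _).2 ⟨by omega, r, hp⟩, ?_⟩
  intro hm
  obtain ⟨-, s, hs⟩ := (mem_partsM _ _).1 hm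
  have hs1 := diag_le hsub s
  have hs2 := row_diff h1 h2 hr s
  have hs3 : nu.parts s = c := by
    by_contra hne
    have hs4 : nu.parts s = c + 1 := by omega
    exact f4 (hr (s, c+1) ⟨by simp, by simp; omega⟩ (fun hy => by have := hy.2; simp at this; omega))
  have := eq_row hnu (r := s) (s := r) (by rw [hs3]; exact f2) (by omega)
  subst this
  omega

theorem removable_facts {h i : ℕ} (h1 : 1 ≤ i) (h2 : 2 * i + 2 < h) {lam : BPartition}
    {x : ℕ × ℕ} (ha : Removable h i lam x) :
    1 ≤ x.2 ∧ colRes h x.2 = i ∧ x.2 ∈ partsM lam ∧ x.2 - 1 ∉ partsM lam := by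
  obtain ⟨hx, mu, hmu, hsub, hxn, hr⟩ := ha
  have hres := hr x hx hxn
  obtain ⟨r, c⟩ := x
  obtain ⟨hc, hcn⟩ := hx
  simp only at *
  have hlt : mu.parts r < c := by
    by_contra hcon
    exact hxn ⟨hc, by simp; omega⟩
  have hd := row_diff h1 h2 hr r
  obtain ⟨f1, f2, f3, f4, f5⟩ := col_facts h1 h2 hc hres
  have hp : mu.parts r = c - 1 := by omega
  refine ⟨hc, hres, (mem_partsM _ _).2 ⟨by omega, r, by omega⟩, ?_⟩
  intro hm
  obtain ⟨-, s, hs⟩ := (mem_partsM _ _).1 hm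
  have hs1 := diag_le hsub s
  have hs3 : mu.parts s = c - 1 := by
    by_contra hne
    exact f5 (hr (s, c-1) ⟨by simp; omega, by simp; omega⟩
      (fun hy => by have := hy.2; simp at this; omega))
  have := eq_row hmu (r := s) (s := r) (by rw [hs3]; exact f3) (by omega)
  subst this
  omega

theorem inv_core {h i : ℕ} (h1 : 1 ≤ i) (h2 : 2 * i + 2 < h) (hodd : h % 2 = 1)
    {sg : BPartition}     (hs : IsBarCore h sg) {k1 k2 : ℤ} (hk : k1 < k2) (hB : (i:ℤ) + k2 * h ∈ abacus sg)
    (hC : (i:ℤ) + 1 + k1 * h ∉ abacus sg) : Inv h i 0 sg := by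
  have nB : ∀ k : ℤ, ¬ (h:ℤ) ∣ (i:ℤ) + k * h := fun k => ndvd h1 h2 _ k (by omega) (by omega)
  have nC : ∀ k : ℤ, ¬ (h:ℤ) ∣ (i:ℤ) + 1 + k * h := fun k => ndvd h1 h2 _ k (by omega) (by omega)
  refine ⟨k2, k1, by omega, ?_, ?_⟩
  · intro k hk
    induction k, hk using Int.le_induction_down with
    | base => exact hB
    | pred k hk ih =>
      have := core_down (by omega) hodd hs (nB k) ih
      rwa [show (i:ℤ) + (k-1) * h = i + k * h - h by ring]
  · intro k hk
    induction k, hk using Int.le_induction with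
    | base => exact hC
    | succ k hk ih =>
      intro hm
      have := core_down (by omega) hodd hs (nC _) hm
      rw [show (i:ℤ) + 1 + (k+1) * h - h = i + 1 + k * h by ring] at this
      exact ih this

end BPartition

open BPartition in
/-- If 1 ≤ i < n and σ is an h-bar-core with at least two addable i-nodes, then no
partition in P_{σ,2} has a removable i-node. -/
theorem stmt8 (n h : ℕ) (hn : 1 ≤ n) (hh : h = 2 * n + 1) (i : ℕ)
    (hi1 : 1 ≤ i) (hi2 : i < n)
    (σ : BPartition) (hσ : IsBarCore h σ)
    (hadd : 2 ≤ Set.ncard {x : ℕ × ℕ | Addable h i σ x}) :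
    ∀ lam, InBlock h σ 2 lam → ∀ x, ¬ Removable h i lam x := by
  intro lam hlam x hx
  have h2 : 2 * i + 2 < h := by omega
  have hfin : {x : ℕ × ℕ | Addable h i σ x}.Finite := Set.finite_of_ncard_pos (by omega)
  obtain ⟨a, b, ha, hb, hab⟩ := (Set.one_lt_ncard_iff hfin).1 hadd
  obtain ⟨a1, a2, a3, a4⟩ := addable_facts hi1 h2 ha
  obtain ⟨b1, b2, b3, b4⟩ := addable_facts hi1 h2 hb
  have hne : a.2 ≠ b.2 := by
    intro he
    apply hab
    refine Prod.ext ?_ he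
    apply eq_row hσ.1
    · rw [a2]; exact (col_facts hi1 h2 a1 ha.1).2.2.1
    · rw [a2, b2, he]
  obtain ⟨ka, ka1, ka2, -⟩ := col_mul hi1 h2 a1 ha.1 σ
  obtain ⟨kb, kb1, kb2, -⟩ := col_mul hi1 h2 b1 hb.1 σ
  have hk : ka ≠ kb := by
    rintro rfl
    omega
  have hI : Inv h i 0 σ := by
    rcases lt_or_gt_of_ne hk with hlt | hlt
    · exact inv_core hi1 h2 (by omega) hσ hlt (kb2 b3 b4).1 (ka2 a3 a4).2
    · exact inv_core hi1 h2 (by omega) hσ hlt (ka2 a3 a4).1 (kb2 b3 b4).2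
  obtain ⟨hl, -, nu, hs1, nu', hs2, he⟩ := hlam
  have he' : nu' = σ := he
  subst he'
  have hnu : IsHStrict h nu := by
    obtain ⟨v, hv⟩ := hs1
    exact hv.1
  obtain ⟨s, t, hst, hB, hC⟩ := inv_step hi1 h2 hl hs1 (inv_step hi1 h2 hnu hs2 hI)
  obtain ⟨r1, r2, r3, r4⟩ := removable_facts hi1 h2 hx
  obtain ⟨k, -, -, hk2⟩ := col_mul hi1 h2 r1 r2 lam
  obtain ⟨c1, c2⟩ := hk2 r3 r4
  rcases le_or_gt k s with h3 | h3
  · exact c1 (hB k h3)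
  · exact hC k (by omega) c2
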